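/- Let k = 3 and l = 8, so that ω' = −5e₀ + 3(e₁ + ⋯ + e₈) in ℤ⁹. Then the set R^8_3 = {v ∈ ℤ⁹ : B(v,v) = −2 and B(v, ω') = 0} has exactly 240 elements (it is a root system of type E₈). -/

import Mathlib

/-- The symmetric bilinear form on `ℤ^{l+1}` with `B(e₀,e₀) = k`, `B(eᵢ,eᵢ) = -1` for
`1 ≤ i ≤ l`, and `B(eᵢ,eⱼ) = 0` for `i ≠ j`. -/
def bformZ (k l : ℕ) (v w : Fin (l + 1) → ℤ) : ℤ :=
  ((k : ℤ) + 1) * (v 0 * w 0) - ∑ i, v i * w i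

/-- The vector `ω' = -(k+2)·e₀ + k·(e₁ + ⋯ + e_l)`. -/
def omegaZ (k l : ℕ) : Fin (l + 1) → ℤ :=
  fun i => if i = 0 then -((k : ℤ) + 2) else (k : ℤ)

/-- The root system `R^l_k = {v ∈ ℤ^{l+1} : B(v,v) = -2, B(v,ω') = 0}`. -/
def rootSet (k l : ℕ) : Set (Fin (l + 1) → ℤ) :=
  {v | bformZ k l v v = -2 ∧ bformZ k l v (omegaZ k l) = 0}

/-- The integer vectors `w` in `ℤ⁸` with prescribed coordinate sum `s` and square sum `q`. -/
def sumSqLayer (s q : ℤ) : Set (Fin 8 → ℤ) :=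
  {w | ∑ i, w i = s ∧ ∑ i, w i ^ 2 = q}

theorem mem_rootSet_iff (v : Fin 9 → ℤ) :
    v ∈ rootSet 3 8 ↔ Fin.tail v ∈ sumSqLayer (-5 * v 0) (3 * v 0 ^ 2 + 2) := by
  simp only [rootSet, bformZ, omegaZ, sumSqLayer, Set.mem_ofPred_eq, Fin.sum_univ_succ (n := 8),
    Fin.tail, Fin.succ_ne_zero, if_true, if_false, ← Finset.sum_mul, pow_two]
  push_cast
  constructor <;> rintro ⟨h₁, h₂⟩ <;> constructor <;> linarith

theorem sumSqLayer_sum_sq_le {s q : ℤ} {w : Fin 8 → ℤ} (hw : w ∈ sumSqLayer s q) :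
    s ^ 2 ≤ 8 * q := by
  have h := sq_sum_le_card_mul_sum_sq (s := Finset.univ) (f := w)
  rw [hw.1, hw.2] at h
  simpa using h

theorem rootSet_head_mem_Icc {v : Fin 9 → ℤ} (hv : v ∈ rootSet 3 8) :
    v 0 ∈ Finset.Icc (-4 : ℤ) 4 := by
  have h := sumSqLayer_sum_sq_le ((mem_rootSet_iff v).1 hv)
  rw [Finset.mem_Icc]
  constructor <;> nlinarith

theorem sumSqLayer_finite (s q : ℤ) : (sumSqLayer s q).Finite := by
  refine (Set.finite_Icc (fun _ => -q) (fun _ => q)).subset fun w hw => ?_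
  have hle (i : Fin 8) : |w i| ≤ q := by
    have h : w i ^ 2 ≤ ∑ j, w j ^ 2 :=
      Finset.single_le_sum (f := fun j => w j ^ 2) (fun j _ => sq_nonneg _) (Finset.mem_univ i)
    rw [hw.2] at h
    rw [← sq_abs] at h
    exact (Int.le_self_sq _).trans h
  exact ⟨fun i => (abs_le.1 (hle i)).1, fun i => (abs_le.1 (hle i)).2⟩

theorem rootSet_fiber (n : ℤ) :
    {v ∈ rootSet 3 8 | v 0 = n} =
      Fin.cons (α := fun _ : Fin 9 => ℤ) n '' sumSqLayer (-5 * n) (3 * n ^ 2 + 2) := by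
  ext v
  constructor
  · rintro ⟨hv, rfl⟩
    exact ⟨Fin.tail v, (mem_rootSet_iff v).1 hv, Fin.cons_self_tail v⟩
  · rintro ⟨w, hw, rfl⟩
    exact ⟨(mem_rootSet_iff _).2 (by simpa using hw), rfl⟩

theorem rootSet_ncard_eq_sum :
    (rootSet 3 8).ncard =
      ∑ n ∈ Finset.Icc (-4 : ℤ) 4, (sumSqLayer (-5 * n) (3 * n ^ 2 + 2)).ncard := by
  have hfin : (rootSet 3 8).Finite := by
    refine ((Finset.Icc (-4 : ℤ) 4).finite_toSet.biUnion fun n _ =>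
      (sumSqLayer_finite (-5 * n) (3 * n ^ 2 + 2)).image
        (Fin.cons (α := fun _ : Fin 9 => ℤ) n)).subset fun v hv => ?_
    simp only [← rootSet_fiber]
    exact Set.mem_biUnion (rootSet_head_mem_Icc hv) ⟨hv, rfl⟩
  rw [Set.ncard_eq_toFinset_card _ hfin, Finset.card_eq_sum_card_fiberwise
    (f := fun v => v 0) (t := Finset.Icc (-4 : ℤ) 4)
    fun v hv => rootSet_head_mem_Icc (by simpa using hv)]
  refine Finset.sum_congr rfl fun n _ => ?_
  rw [← Set.ncard_image_of_injective _ (Fin.cons_right_injective (α := fun _ => ℤ) n),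
    ← rootSet_fiber, ← Set.ncard_coe_finset]
  congr 1
  ext v
  simp

theorem sumSqLayer_ncard_neg (s q : ℤ) :
    (sumSqLayer (-s) q).ncard = (sumSqLayer s q).ncard := by
  rw [← Set.ncard_image_of_injective (sumSqLayer s q) neg_injective]
  congr 1
  ext w
  simp [sumSqLayer, neg_eq_iff_eq_neg]

theorem sumSqLayer_ncard_sub_one (s q : ℤ) :
    (sumSqLayer s q).ncard = (sumSqLayer (s - 8) (q - 2 * s + 8)).ncard := by
  rw [← Set.ncard_image_of_injective (sumSqLayer s q)
    (sub_left_injective (b := (1 : Fin 8 → ℤ)))]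
  congr 1
  ext w
  simp only [Set.mem_image, sumSqLayer, Set.mem_ofPred_eq]
  have hsum (u : Fin 8 → ℤ) : ∑ i, (u i + 1) = ∑ i, u i + 8 := by
    simp [Finset.sum_add_distrib]
  have hsq (u : Fin 8 → ℤ) : ∑ i, (u i + 1) ^ 2 = ∑ i, u i ^ 2 + 2 * ∑ i, u i + 8 := by
    simp [add_sq, Finset.sum_add_distrib, Finset.mul_sum]
  constructor
  · rintro ⟨u, ⟨h₁, h₂⟩, rfl⟩
    have h₃ := hsum (u - 1)
    have h₄ := hsq (u - 1)
    simp only [Pi.sub_apply, Pi.one_apply, sub_add_cancel] at h₃ h₄ ⊢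
    constructor <;> linarith
  · rintro ⟨h₁, h₂⟩
    refine ⟨w + 1, ⟨?_, ?_⟩, add_sub_cancel_right w 1⟩
    · simp only [Pi.add_apply, Pi.one_apply, hsum]
      linarith
    · simp only [Pi.add_apply, Pi.one_apply, hsq]
      linarith

/-- If the sum equals the square sum, all coordinates are `0` or `1`. -/
theorem sumSqLayer_ncard_self (r : ℕ) : (sumSqLayer r r).ncard = Nat.choose 8 r := by
  have hinj : Function.Injective fun (A : Finset (Fin 8)) (i : Fin 8) =>
      if i ∈ A then (1 : ℤ) else 0 := by
    intro A B h
    ext i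
    have hi := congrFun h i
    by_cases hA : i ∈ A <;> by_cases hB : i ∈ B <;> simp_all
  have himage : sumSqLayer r r = (fun (A : Finset (Fin 8)) (i : Fin 8) =>
      if i ∈ A then (1 : ℤ) else 0) ''
        (Finset.powersetCard r Finset.univ : Finset (Finset (Fin 8))) := by
    ext w
    constructor
    · rintro ⟨h₁, h₂⟩
      have hzero : ∑ i, (w i ^ 2 - w i) = 0 := by
        rw [Finset.sum_sub_distrib, h₁, h₂, sub_self]
      rw [Finset.sum_eq_zero_iff_of_nonneg
        fun i _ => sub_nonneg.2 (Int.le_self_sq (w i))] at hzero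
      have hw : (fun i => if i ∈ Finset.univ.filter (w · = 1) then (1 : ℤ) else 0) = w := by
        funext i
        have hi : w i * (w i - 1) = 0 := by linarith [hzero i (Finset.mem_univ i)]
        rcases mul_eq_zero.1 hi with h | h
        · simp [h]
        · simp [sub_eq_zero.1 h]
      refine ⟨Finset.univ.filter (w · = 1), ?_, hw⟩
      rw [← hw] at h₁
      simpa using h₁
    · rintro ⟨A, hA, rfl⟩
      have hA : A.card = r := by simpa using hA
      simp [sumSqLayer, hA]
  rw [himage, Set.ncard_image_of_injective _ hinj, Set.ncard_coe_finset]
  simp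

/-- The vectors of sum `0` and square sum `2` are the differences `eᵢ - eⱼ` with `i ≠ j`. -/
theorem sumSqLayer_zero_two_ncard : (sumSqLayer 0 2).ncard = 56 := by
  set f : Fin 8 × Fin 8 → Fin 8 → ℤ := fun p => Pi.single p.1 1 - Pi.single p.2 1 with hf
  have himage : sumSqLayer 0 2 = f '' (Finset.univ.offDiag : Finset (Fin 8 × Fin 8)) := by
    ext w
    constructor
    · rintro ⟨h₁, h₂⟩
      have hne : ∃ i ∈ Finset.univ, w i ≠ 0 := by
        by_contra! h
        simp [h] at h₂
      obtain ⟨i, -, hi⟩ := Finset.exists_pos_of_sum_zero_of_exists_nonzero w h₁ hne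
      obtain ⟨j, -, hj⟩ := Finset.exists_pos_of_sum_zero_of_exists_nonzero (-w)
        (by simpa using h₁) (by simpa using hne)
      have hj : w j < 0 := by simpa using hj
      have hij : i ≠ j := by
        rintro rfl
        exact hi.not_gt hj
      have hexpand : ∑ k, (w k - f (i, j) k) ^ 2 = 4 - 2 * (w i - w j) := by
        have hk (k : Fin 8) : (w k - f (i, j) k) ^ 2 = w k ^ 2 +
            (if k = i then 1 - 2 * w k else 0) + (if k = j then 1 + 2 * w k else 0) := by
          by_cases hki : k = i
          · subst hki
            simp [hf, hij]
            ring
          · by_cases hkj : k = j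
            · subst hkj
              simp [hf, hki]
              ring
            · simp [hf, hki, hkj]
        simp only [hk, Finset.sum_add_distrib, h₂]
        simp
        ring
      have hzero : ∑ k, (w k - f (i, j) k) ^ 2 = 0 :=
        le_antisymm (by omega) (Finset.sum_nonneg fun k _ => sq_nonneg _)
      rw [Finset.sum_eq_zero_iff_of_nonneg fun k _ => sq_nonneg _] at hzero
      refine ⟨(i, j), by simpa using hij, funext fun k => ?_⟩
      exact (sub_eq_zero.1 (pow_eq_zero_iff two_ne_zero |>.1 (hzero k (Finset.mem_univ k)))).symm
    · rintro ⟨⟨i, j⟩, hij, rfl⟩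
      have hij : i ≠ j := by simpa using hij
      revert i j
      unfold sumSqLayer
      decide
  have hinj : Set.InjOn f (Finset.univ.offDiag : Finset (Fin 8 × Fin 8)) := by
    rintro ⟨i, j⟩ hij ⟨k, l⟩ hkl h
    have hij : i ≠ j := by simpa using hij
    have hkl : k ≠ l := by simpa using hkl
    have hi := congrFun h i
    have hj := congrFun h j
    simp only [hf, Pi.sub_apply, Pi.single_apply] at hi hj
    grind
  rw [himage, hinj.ncard_image, Set.ncard_coe_finset]
  decide

theorem sumSqLayer_twenty_fifty : sumSqLayer 20 50 = ∅ := by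
  refine Set.eq_empty_of_forall_notMem fun w ⟨h₁, h₂⟩ => ?_
  have hzero : ∑ i, (2 * w i - 5) ^ 2 = 0 := by
    have h (i : Fin 8) : (2 * w i - 5) ^ 2 = 4 * w i ^ 2 - 20 * w i + 25 := by ring
    simp only [h, Finset.sum_add_distrib, Finset.sum_sub_distrib, ← Finset.mul_sum, h₁, h₂]
    simp
  rw [Finset.sum_eq_zero_iff_of_nonneg fun i _ => sq_nonneg _] at hzero
  have h := pow_eq_zero_iff two_ne_zero |>.1 (hzero 0 (Finset.mem_univ 0))
  omega

/-- For `k = 3` and `l = 8`, the root system `R^8_3` (of type `E₈`) has exactly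
`240` elements. -/
theorem rootSet_card_E8 : (rootSet 3 8).ncard = 240 := by
  have h₁ : (sumSqLayer 5 5).ncard = 56 := sumSqLayer_ncard_self 5
  have h₂ : (sumSqLayer 10 14).ncard = 28 :=
    (sumSqLayer_ncard_sub_one 10 14).trans (sumSqLayer_ncard_self 2)
  have h₃ : (sumSqLayer 15 29).ncard = 8 :=
    (sumSqLayer_ncard_sub_one 15 29).trans (sumSqLayer_ncard_self 7)
  have h₄ : (sumSqLayer 20 50).ncard = 0 := by rw [sumSqLayer_twenty_fifty, Set.ncard_empty]
  have hIcc : Finset.Icc (-4 : ℤ) 4 = {-4, -3, -2, -1, 0, 1, 2, 3, 4} := by decide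
  rw [rootSet_ncard_eq_sum, hIcc]
  norm_num [sumSqLayer_ncard_neg, h₁, h₂, h₃, h₄, sumSqLayer_zero_two_ncard]
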